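/- arXiv:2304.04308 — 2 statements merged into one kernel-verified Lean document; each statement's English description precedes it below -/
import Mathlib

section
/- (Adaptive Ridge, Example 2) Let λ ≥ 0, y ∈ ℝ^T, X̃ ∈ ℝ^{T×T·m} the block-diagonal forecast matrix, and U_{F_2} = {Δ ∈ ℝ^{T×T·m} : ‖Δ‖_{F_2} ≤ λ} the Frobenius-norm ball of radius λ. Then inf_{β ∈ Ω_adapt} sup_{Δ ∈ U_{F_2}} ‖y − (X̃ + Δ)β‖_2 = inf_{β ∈ Ω_adapt} ( ‖y − X̃β‖_2 + λ·‖β‖_2 ). -/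
open scoped ENNReal

/-- The `ℓ_p` norm of a finite real vector, for `p ∈ [1, ∞]`
(`(∑ i, |x i| ^ p)^(1/p)` for finite `p`, `max_i |x i|` for `p = ∞`). -/
noncomputable def lpNorm (p : ℝ≥0∞) {ι : Type} [Fintype ι] (x : ι → ℝ) : ℝ :=
  if p = ∞ then ⨆ i, |x i| else (∑ i, |x i| ^ p.toReal) ^ (1 / p.toReal)

/-- The vector of past forecast errors
`Z_t = [X_{t-τ} - y_{t-τ} e | … | X_{t-1} - y_{t-1} e] ∈ ℝ^{m·τ}`
(time is indexed by `ℤ` so that the values for times `s ≤ 0` are the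
"additional fixed values" handling the edge cases). -/
def Zvec (m τ : ℕ) (X : ℤ → Fin m → ℝ) (y : ℤ → ℝ) (t : ℤ) : Fin τ × Fin m → ℝ :=
  fun s => X (t - τ + s.1) s.2 - y (t - τ + s.1)

/-- The adaptive set `Ω_adapt ⊆ ℝ^{T·m}`: all concatenated vectors `β = [β_1|…|β_T]`
with `β_t = β₀ + V₀ · Z_t` for all `t = 1, …, T`, for some `β₀ ∈ ℝ^m` and
`V₀ ∈ ℝ^{m × m·τ}` (row `t : Fin T` of the data corresponds to time `t + 1 ∈ ℤ`). -/
def OmegaAdapt (T m τ : ℕ) (X : ℤ → Fin m → ℝ) (y : ℤ → ℝ) :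
    Set (Fin T × Fin m → ℝ) :=
  {β | ∃ (β₀ : Fin m → ℝ) (V₀ : Matrix (Fin m) (Fin τ × Fin m) ℝ),
    ∀ (t : Fin T) (j : Fin m),
      β (t, j) = β₀ j + V₀.mulVec (Zvec m τ X y ((t : ℤ) + 1)) j}

/-- The block-diagonal forecast matrix `X̃ ∈ ℝ^{T × T·m}` whose `t`-th diagonal block is
`X_tᵀ`, so that `(X̃ β)_t = X_tᵀ β_t`. -/
def blockDiag (T m : ℕ) (X : ℤ → Fin m → ℝ) : Matrix (Fin T) (Fin T × Fin m) ℝ :=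
  fun t c => if c.1 = t then X ((t : ℤ) + 1) c.2 else 0

/-- The target vector `y ∈ ℝ^T`. -/
def targetVec (T : ℕ) (y : ℤ → ℝ) : Fin T → ℝ := fun t => y ((t : ℤ) + 1)

/-- The entrywise Frobenius `p`-norm of a real matrix. -/
noncomputable def frobNorm (p : ℝ≥0∞) {ι κ : Type} [Fintype ι] [Fintype κ]
    (Δ : Matrix ι κ ℝ) : ℝ :=
  lpNorm p (fun c : ι × κ => Δ c.1 c.2)

theorem lpNorm_two_eq_sqrt {ι : Type} [Fintype ι] (x : ι → ℝ) :
    lpNorm 2 x = √(∑ i, x i ^ 2) := by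
  simp [lpNorm, Real.sqrt_eq_rpow]

theorem lpNorm_two_eq_norm {ι : Type} [Fintype ι] (x : ι → ℝ) :
    lpNorm 2 x = ‖WithLp.toLp 2 x‖ := by
  simp [lpNorm_two_eq_sqrt, EuclideanSpace.norm_eq]

theorem lpNorm_two_nonneg {ι : Type} [Fintype ι] (x : ι → ℝ) : 0 ≤ lpNorm 2 x := by
  rw [lpNorm_two_eq_norm]
  exact norm_nonneg _

theorem lpNorm_two_smul {ι : Type} [Fintype ι] (a : ℝ) (x : ι → ℝ) :
    lpNorm 2 (a • x) = |a| * lpNorm 2 x := by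
  rw [lpNorm_two_eq_norm, lpNorm_two_eq_norm, WithLp.toLp_smul, norm_smul, Real.norm_eq_abs]

theorem lpNorm_two_sub_le {ι : Type} [Fintype ι] (x z : ι → ℝ) :
    lpNorm 2 (x - z) ≤ lpNorm 2 x + lpNorm 2 z := by
  simp only [lpNorm_two_eq_norm, WithLp.toLp_sub]
  exact norm_sub_le _ _

theorem dotProduct_self_eq_lpNorm_two_sq {ι : Type} [Fintype ι] (x : ι → ℝ) :
    x ⬝ᵥ x = lpNorm 2 x ^ 2 := by
  rw [lpNorm_two_eq_sqrt, Real.sq_sqrt (Finset.sum_nonneg fun i _ => sq_nonneg (x i))]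
  simp [dotProduct, sq]

theorem lpNorm_two_mulVec_le {ι κ : Type} [Fintype ι] [Fintype κ]
    (Δ : Matrix ι κ ℝ) (β : κ → ℝ) :
    lpNorm 2 (Δ.mulVec β) ≤ frobNorm 2 Δ * lpNorm 2 β := by
  rw [frobNorm, lpNorm_two_eq_sqrt, lpNorm_two_eq_sqrt, lpNorm_two_eq_sqrt,
    ← Real.sqrt_mul (Finset.sum_nonneg fun c _ => sq_nonneg _), Fintype.sum_prod_type,
    Finset.sum_mul]
  exact Real.sqrt_le_sqrt
    (Finset.sum_le_sum fun i _ => Finset.sum_mul_sq_le_sq_mul_sq Finset.univ (Δ i) β)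

theorem frobNorm_two_vecMulVec {ι κ : Type} [Fintype ι] [Fintype κ] (u : ι → ℝ) (v : κ → ℝ) :
    frobNorm 2 (Matrix.vecMulVec u v) = lpNorm 2 u * lpNorm 2 v := by
  rw [frobNorm, lpNorm_two_eq_sqrt, lpNorm_two_eq_sqrt, lpNorm_two_eq_sqrt,
    ← Real.sqrt_mul (Finset.sum_nonneg fun c _ => sq_nonneg _), Fintype.sum_prod_type,
    Finset.sum_mul_sum]
  simp only [Matrix.vecMulVec_apply, mul_pow]

theorem exists_unit_direction {ι : Type} [Fintype ι] [Nonempty ι] (r : ι → ℝ) :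
    ∃ u : ι → ℝ, lpNorm 2 u = 1 ∧ r = lpNorm 2 r • u := by
  classical
  by_cases h : lpNorm 2 r = 0
  · obtain ⟨i⟩ := ‹Nonempty ι›
    refine ⟨Pi.single i 1, by simp [lpNorm_two_eq_sqrt, Pi.single_apply], ?_⟩
    rw [h, zero_smul]
    rw [lpNorm_two_eq_norm, norm_eq_zero] at h
    simpa using h
  · refine ⟨(lpNorm 2 r)⁻¹ • r, ?_, by rw [smul_inv_smul₀ h]⟩
    rw [lpNorm_two_smul, abs_of_nonneg (inv_nonneg.2 (lpNorm_two_nonneg r)), inv_mul_cancel₀ h]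

theorem exists_frobNorm_le_lpNorm_sub_mulVec_eq {ι κ : Type} [Fintype ι] [Fintype κ] [Nonempty ι]
    {lam : ℝ} (hlam : 0 ≤ lam) (r : ι → ℝ) (β : κ → ℝ) :
    ∃ Δ : Matrix ι κ ℝ, frobNorm 2 Δ ≤ lam ∧
      lpNorm 2 (r - Δ.mulVec β) = lpNorm 2 r + lam * lpNorm 2 β := by
  obtain ⟨u, hu, hr⟩ := exists_unit_direction r
  have hβ := lpNorm_two_nonneg β
  refine ⟨Matrix.vecMulVec u ((-(lam / lpNorm 2 β)) • β), ?_, ?_⟩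
  · rw [frobNorm_two_vecMulVec, hu, lpNorm_two_smul, one_mul, abs_neg,
      abs_of_nonneg (div_nonneg hlam hβ)]
    rcases eq_or_ne (lpNorm 2 β) 0 with h | h
    · simpa [h] using hlam
    · rw [div_mul_cancel₀ _ h]
  · have hmul : (Matrix.vecMulVec u ((-(lam / lpNorm 2 β)) • β)).mulVec β
        = (-(lam * lpNorm 2 β)) • u := by
      rw [Matrix.vecMulVec_mulVec, op_smul_eq_smul, smul_dotProduct,
        dotProduct_self_eq_lpNorm_two_sq, smul_eq_mul]
      congr 1
      by_cases h : lpNorm 2 β = 0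
      · simp [h]
      · field_simp
    have hsum : r - (-(lam * lpNorm 2 β)) • u = (lpNorm 2 r + lam * lpNorm 2 β) • u := by
      rw [neg_smul, sub_neg_eq_add, add_smul, ← hr]
    rw [hmul, hsum, lpNorm_two_smul, hu, mul_one,
      abs_of_nonneg (add_nonneg (lpNorm_two_nonneg r) (mul_nonneg hlam hβ))]

theorem isGreatest_lpNorm_sub_mulVec_frobNorm_ball {ι κ : Type} [Fintype ι] [Fintype κ]
    [Nonempty ι] {lam : ℝ} (hlam : 0 ≤ lam) (z : ι → ℝ) (A : Matrix ι κ ℝ) (β : κ → ℝ) :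
    IsGreatest ((fun Δ : Matrix ι κ ℝ => lpNorm 2 (z - (A + Δ).mulVec β)) ''
        {Δ | frobNorm 2 Δ ≤ lam})
      (lpNorm 2 (z - A.mulVec β) + lam * lpNorm 2 β) := by
  simp only [Matrix.add_mulVec, ← sub_sub]
  refine ⟨exists_frobNorm_le_lpNorm_sub_mulVec_eq hlam _ β, ?_⟩
  rintro _ ⟨Δ, hΔ, rfl⟩
  calc lpNorm 2 (z - A.mulVec β - Δ.mulVec β)
      ≤ lpNorm 2 (z - A.mulVec β) + lpNorm 2 (Δ.mulVec β) := lpNorm_two_sub_le _ _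
    _ ≤ lpNorm 2 (z - A.mulVec β) + frobNorm 2 Δ * lpNorm 2 β := by
        gcongr
        exact lpNorm_two_mulVec_le Δ β
    _ ≤ lpNorm 2 (z - A.mulVec β) + lam * lpNorm 2 β := by
        gcongr
        · exact lpNorm_two_nonneg β
        · exact hΔ

/-- Adaptive Ridge, Example 2: with the Frobenius 2-norm ball
`U_{F_2} = {Δ : ‖Δ‖_{F_2} ≤ λ}`,
`inf_{β ∈ Ω_adapt} sup_{Δ ∈ U_{F_2}} ‖y − (X̃ + Δ)β‖_2
  = inf_{β ∈ Ω_adapt} (‖y − X̃β‖_2 + λ‖β‖_2)`. -/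
theorem statement8 {T m τ : ℕ} (hτ : 1 ≤ τ)
    (lam : ℝ) (hlam : 0 ≤ lam) (X : ℤ → Fin m → ℝ) (y : ℤ → ℝ) :
    sInf ((fun β : Fin T × Fin m → ℝ =>
        sSup ((fun Δ : Matrix (Fin T) (Fin T × Fin m) ℝ =>
            lpNorm 2 (targetVec T y - (blockDiag T m X + Δ).mulVec β)) ''
          {Δ : Matrix (Fin T) (Fin T × Fin m) ℝ | frobNorm 2 Δ ≤ lam})) ''
      OmegaAdapt T m τ X y)
    = sInf ((fun β : Fin T × Fin m → ℝ =>
        lpNorm 2 (targetVec T y - (blockDiag T m X).mulVec β) + lam * lpNorm 2 β) ''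
      OmegaAdapt T m τ X y) := by
  congr 1
  refine Set.image_congr fun β _ => ?_
  rcases T.eq_zero_or_pos with rfl | hT
  · have hball : {Δ : Matrix (Fin 0) (Fin 0 × Fin m) ℝ | frobNorm 2 Δ ≤ lam}.Nonempty :=
      ⟨0, by simpa [frobNorm, lpNorm_two_eq_sqrt] using hlam⟩
    simp [lpNorm_two_eq_sqrt, hball.image_const]
  · have : Nonempty (Fin T) := ⟨⟨0, hT⟩⟩
    exact (isGreatest_lpNorm_sub_mulVec_frobNorm_ball hlam _ _ β).csSup_eq
end

section
/- (Corollary 1) Let p ∈ [1, ∞] with conjugate exponent p* satisfying 1/p + 1/p* = 1, λ ≥ 0, y ∈ ℝ^T, X̃ ∈ ℝ^{T×T·m} the block-diagonal forecast matrix, and U_{F_p} = {Δ ∈ ℝ^{T×T·m} : ‖Δ‖_{F_p} ≤ λ}. Then inf_{β ∈ Ω_adapt} sup_{Δ ∈ U_{F_p}} ‖y − (X̃ + Δ)β‖_p = inf_{β ∈ Ω_adapt} ( ‖y − X̃β‖_p + λ·‖β‖_{p*} ). -/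
open scoped ENNReal

theorem lpNorm_top {ι : Type} [Fintype ι] (x : ι → ℝ) : lpNorm ∞ x = ⨆ i, |x i| :=
  if_pos rfl

theorem lpNorm_of_ne_top {p : ℝ≥0∞} (hp : p ≠ ∞) {ι : Type} [Fintype ι] (x : ι → ℝ) :
    lpNorm p x = (∑ i, |x i| ^ p.toReal) ^ (1 / p.toReal) :=
  if_neg hp

theorem lpNorm_one {ι : Type} [Fintype ι] (x : ι → ℝ) : lpNorm 1 x = ∑ i, |x i| := by
  simp [lpNorm_of_ne_top]

theorem toReal_pos_of_one_le {p : ℝ≥0∞} (hp : 1 ≤ p) (hp' : p ≠ ∞) : 0 < p.toReal :=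
  ENNReal.toReal_pos (zero_lt_one.trans_le hp).ne' hp'

theorem lpNorm_eq_norm {p : ℝ≥0∞} (hp : 1 ≤ p) {ι : Type} [Fintype ι] (x : ι → ℝ) :
    lpNorm p x = ‖WithLp.toLp p x‖ := by
  by_cases h : p = ∞
  · subst h
    rw [lpNorm_top, PiLp.norm_eq_ciSup]
    rfl
  · rw [lpNorm_of_ne_top h, PiLp.norm_eq_sum (toReal_pos_of_one_le hp h)]
    rfl

theorem lpNorm_nonneg {p : ℝ≥0∞} (hp : 1 ≤ p) {ι : Type} [Fintype ι] (x : ι → ℝ) :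
    0 ≤ lpNorm p x := by
  have : Fact (1 ≤ p) := ⟨hp⟩
  rw [lpNorm_eq_norm hp]
  exact norm_nonneg _

theorem lpNorm_sub_le {p : ℝ≥0∞} (hp : 1 ≤ p) {ι : Type} [Fintype ι] (x y : ι → ℝ) :
    lpNorm p (x - y) ≤ lpNorm p x + lpNorm p y := by
  have : Fact (1 ≤ p) := ⟨hp⟩
  simp only [lpNorm_eq_norm hp, WithLp.toLp_sub]
  exact norm_sub_le _ _

theorem lpNorm_smul {p : ℝ≥0∞} (hp : 1 ≤ p) {ι : Type} [Fintype ι] (c : ℝ) (x : ι → ℝ) :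
    lpNorm p (c • x) = |c| * lpNorm p x := by
  have : Fact (1 ≤ p) := ⟨hp⟩
  simp only [lpNorm_eq_norm hp, WithLp.toLp_smul]
  exact norm_smul _ _

theorem lpNorm_zero {p : ℝ≥0∞} (hp : 1 ≤ p) {ι : Type} [Fintype ι] :
    lpNorm p (0 : ι → ℝ) = 0 := by
  simpa using lpNorm_smul hp 0 (0 : ι → ℝ)

theorem lpNorm_of_isEmpty {p : ℝ≥0∞} (hp : 1 ≤ p) {ι : Type} [Fintype ι] [IsEmpty ι]
    (x : ι → ℝ) : lpNorm p x = 0 := by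
  rw [Subsingleton.elim x 0, lpNorm_zero hp]

theorem lpNorm_mono {p : ℝ≥0∞} (hp : 1 ≤ p) {ι : Type} [Fintype ι] {x y : ι → ℝ}
    (h : ∀ i, |x i| ≤ |y i|) : lpNorm p x ≤ lpNorm p y := by
  by_cases hp' : p = ∞
  · subst hp'
    rw [lpNorm_top, lpNorm_top]
    exact ciSup_mono (Set.finite_range _).bddAbove h
  · rw [lpNorm_of_ne_top hp', lpNorm_of_ne_top hp']
    have := toReal_pos_of_one_le hp hp'
    refine Real.rpow_le_rpow (by positivity) (Finset.sum_le_sum fun i _ => ?_) (by positivity)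
    exact Real.rpow_le_rpow (abs_nonneg _) (h i) this.le

theorem abs_le_lpNorm_top {ι : Type} [Fintype ι] (x : ι → ℝ) (i : ι) : |x i| ≤ lpNorm ∞ x := by
  rw [lpNorm_top]
  exact le_ciSup (f := fun i => |x i|) (Set.finite_range _).bddAbove i

/-- The entrywise norm of a matrix is the `ℓ_p` norm of the vector of `ℓ_p` norms of its rows. -/
theorem frobNorm_eq_lpNorm_rows {p : ℝ≥0∞} (hp : 1 ≤ p) {ι κ : Type} [Fintype ι] [Fintype κ]
    (Δ : Matrix ι κ ℝ) : frobNorm p Δ = lpNorm p (fun i => lpNorm p (Δ i)) := by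
  unfold frobNorm
  by_cases hp' : p = ∞
  · subst hp'
    have hnn := fun i => lpNorm_nonneg le_top (Δ i)
    apply le_antisymm
    · rw [lpNorm_top]
      refine Real.iSup_le (fun c => ?_) (lpNorm_nonneg le_top _)
      refine (abs_le_lpNorm_top (Δ c.1) c.2).trans ?_
      exact (le_abs_self _).trans (abs_le_lpNorm_top (fun i => lpNorm ∞ (Δ i)) c.1)
    · rw [lpNorm_top (fun i => lpNorm ∞ (Δ i))]
      refine Real.iSup_le (fun i => ?_) (lpNorm_nonneg le_top _)
      rw [abs_of_nonneg (hnn i), lpNorm_top (Δ i)]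
      refine Real.iSup_le (fun j => ?_) (lpNorm_nonneg le_top _)
      exact abs_le_lpNorm_top (fun c : ι × κ => Δ c.1 c.2) (i, j)
  · have h0 := toReal_pos_of_one_le hp hp'
    rw [lpNorm_of_ne_top hp', lpNorm_of_ne_top hp', Fintype.sum_prod_type]
    congr 1
    refine Finset.sum_congr rfl fun i _ => ?_
    rw [abs_of_nonneg (lpNorm_nonneg hp _), lpNorm_of_ne_top hp', one_div,
      Real.rpow_inv_rpow (by positivity) h0.ne']

theorem frobNorm_vecMulVec {p : ℝ≥0∞} (hp : 1 ≤ p) {ι κ : Type} [Fintype ι] [Fintype κ]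
    (u : ι → ℝ) (v : κ → ℝ) :
    frobNorm p (Matrix.vecMulVec u v) = lpNorm p u * lpNorm p v := by
  have hrow : ∀ i, lpNorm p (Matrix.vecMulVec u v i) = |u i| * lpNorm p v :=
    fun i => lpNorm_smul hp (u i) v
  have hrows : (fun i => lpNorm p (Matrix.vecMulVec u v i)) = lpNorm p v • fun i => |u i| := by
    ext i
    simp [hrow, mul_comm]
  rw [frobNorm_eq_lpNorm_rows hp, hrows, lpNorm_smul hp, abs_of_nonneg (lpNorm_nonneg hp v),
    mul_comm]
  congr 1
  exact le_antisymm (lpNorm_mono hp (by simp)) (lpNorm_mono hp (by simp))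

theorem lpNorm_holder {p q : ℝ≥0∞} [h : ENNReal.HolderConjugate p q] {ι : Type} [Fintype ι]
    (x y : ι → ℝ) : |x ⬝ᵥ y| ≤ lpNorm p x * lpNorm q y := by
  have aux : ∀ x y : ι → ℝ, ∑ i, |x i| * |y i| ≤ lpNorm ∞ x * lpNorm 1 y := by
    intro x y
    rw [lpNorm_one, Finset.mul_sum]
    gcongr with i
    exact abs_le_lpNorm_top x i
  have habs : |x ⬝ᵥ y| ≤ ∑ i, |x i| * |y i| := by
    simpa [dotProduct, abs_mul] using Finset.abs_sum_le_sum_abs (fun i => x i * y i) Finset.univ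
  refine habs.trans ?_
  by_cases hp : p = ∞
  · obtain rfl := (ENNReal.HolderConjugate.eq_top_iff_eq_one p q).1 hp
    subst hp
    exact aux x y
  by_cases hq : q = ∞
  · obtain rfl := (ENNReal.HolderConjugate.eq_top_iff_eq_one q p).1 hq
    subst hq
    simpa only [mul_comm] using aux y x
  · rw [lpNorm_of_ne_top hp, lpNorm_of_ne_top hq]
    simpa using Real.inner_le_Lp_mul_Lq Finset.univ (fun i => |x i|) (fun i => |y i|)
      (ENNReal.HolderConjugate.toReal_of_ne_top hp hq)

/-- The bound of Hölder's inequality is attained in the unit ball. -/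
theorem exists_dotProduct_eq_lpNorm {p q : ℝ≥0∞} [h : ENNReal.HolderConjugate p q]
    {ι : Type} [Fintype ι] (y : ι → ℝ) :
    ∃ v : ι → ℝ, lpNorm p v ≤ 1 ∧ v ⬝ᵥ y = lpNorm q y := by
  have hsign : ∀ a : ℝ, |(SignType.sign a : ℝ)| ≤ 1 := by
    intro a
    rcases lt_trichotomy a 0 with ha | ha | ha <;> simp [ha]
  by_cases hp : p = ∞
  · obtain rfl := (ENNReal.HolderConjugate.eq_top_iff_eq_one p q).1 hp
    subst hp
    refine ⟨fun i => SignType.sign (y i), ?_, ?_⟩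
    · rw [lpNorm_top]
      exact Real.iSup_le (fun i => hsign _) zero_le_one
    · simp [lpNorm_one, dotProduct, sign_mul_self]
  by_cases hq : q = ∞
  · obtain rfl := (ENNReal.HolderConjugate.eq_top_iff_eq_one q p).1 hq
    subst hq
    classical
    rcases isEmpty_or_nonempty ι with hι | hι
    · exact ⟨0, by simp [lpNorm_one], by simp [lpNorm_top]⟩
    · obtain ⟨i, hi⟩ := exists_eq_ciSup_of_finite (f := fun i => |y i|)
      refine ⟨Pi.single i (SignType.sign (y i) : ℝ), ?_, ?_⟩
      · rw [lpNorm_one, Finset.sum_eq_single i (fun j _ hj => by simp [hj]) (by simp)]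
        simpa using hsign (y i)
      · rw [lpNorm_top, ← hi, single_dotProduct, sign_mul_self]
  · have hpq := ENNReal.HolderConjugate.toReal_of_ne_top (p := p) (q := q) hp hq
    obtain ⟨g, hg, hgy⟩ := (NNReal.isGreatest_Lp Finset.univ (fun i => Real.nnabs (y i))
      hpq.symm).1
    have hg' : ∑ i, (g i : ℝ) ^ p.toReal ≤ 1 := by exact_mod_cast hg
    have hgy' := congrArg NNReal.toReal hgy
    push_cast at hgy'
    refine ⟨fun i => SignType.sign (y i) * g i, ?_, ?_⟩
    · rw [lpNorm_of_ne_top hp]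
      refine Real.rpow_le_one (by positivity) (le_trans ?_ hg') (by positivity)
      gcongr with i
      rw [abs_mul, NNReal.abs_eq]
      exact mul_le_of_le_one_left (g i).2 (hsign _)
    · rw [lpNorm_of_ne_top hq]
      rw [← hgy']
      refine Finset.sum_congr rfl fun i _ => ?_
      rw [← sign_mul_self (y i)]
      ring

theorem exists_lpNorm_eq_one_smul_eq {p : ℝ≥0∞} (hp : 1 ≤ p) {ι : Type} [Fintype ι] [Nonempty ι]
    (r : ι → ℝ) : ∃ u : ι → ℝ, lpNorm p u = 1 ∧ r = lpNorm p r • u := by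
  have : Fact (1 ≤ p) := ⟨hp⟩
  have key : ∀ x : ι → ℝ, x ≠ 0 → lpNorm p ((lpNorm p x)⁻¹ • x) = 1 ∧ lpNorm p x ≠ 0 := by
    intro x hx
    have h0 : lpNorm p x ≠ 0 := by
      rw [lpNorm_eq_norm hp]
      simpa using hx
    refine ⟨?_, h0⟩
    rw [lpNorm_smul hp, abs_of_nonneg (inv_nonneg.2 (lpNorm_nonneg hp x)), inv_mul_cancel₀ h0]
  by_cases hr : r = 0
  · refine ⟨_, (key 1 one_ne_zero).1, ?_⟩
    simp [hr, lpNorm_zero hp]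
  · exact ⟨_, (key r hr).1, by rw [smul_inv_smul₀ (key r hr).2]⟩

theorem lpNorm_mulVec_le {p q : ℝ≥0∞} (hp : 1 ≤ p) (hq : 1 ≤ q) [ENNReal.HolderConjugate p q]
    {ι κ : Type} [Fintype ι] [Fintype κ] (Δ : Matrix ι κ ℝ) (β : κ → ℝ) :
    lpNorm p (Δ.mulVec β) ≤ frobNorm p Δ * lpNorm q β := by
  have hβ := lpNorm_nonneg hq β
  rw [frobNorm_eq_lpNorm_rows hp, mul_comm]
  nth_rewrite 1 [← abs_of_nonneg hβ]
  rw [← lpNorm_smul hp]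
  refine lpNorm_mono hp fun i => ?_
  refine (lpNorm_holder (p := p) (q := q) (Δ i) β).trans ?_
  rw [Pi.smul_apply, smul_eq_mul, mul_comm]
  exact le_abs_self _

/-- The worst-case `ℓ_p` residual over the Frobenius `p`-ball is the regularized residual. -/
theorem isGreatest_lpNorm_sub_mulVec {p q : ℝ≥0∞} (hp : 1 ≤ p) (hq : 1 ≤ q)
    [ENNReal.HolderConjugate p q] {ι κ : Type} [Fintype ι] [Fintype κ] [Nonempty ι]
    {lam : ℝ} (hlam : 0 ≤ lam) (A : Matrix ι κ ℝ) (b : ι → ℝ) (β : κ → ℝ) :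
    IsGreatest ((fun Δ : Matrix ι κ ℝ => lpNorm p (b - (A + Δ).mulVec β)) ''
      {Δ : Matrix ι κ ℝ | frobNorm p Δ ≤ lam})
      (lpNorm p (b - A.mulVec β) + lam * lpNorm q β) := by
  have hβ := lpNorm_nonneg hq β
  constructor
  · obtain ⟨u, hu, hr⟩ := exists_lpNorm_eq_one_smul_eq hp (b - A.mulVec β)
    obtain ⟨v, hv, hvβ⟩ := exists_dotProduct_eq_lpNorm (p := p) (q := q) β
    refine ⟨Matrix.vecMulVec ((-lam) • u) v, ?_, ?_⟩
    · rw [Set.mem_ofPred_eq, frobNorm_vecMulVec hp, lpNorm_smul hp, hu, abs_neg,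
        abs_of_nonneg hlam, mul_one]
      exact mul_le_of_le_one_right hlam hv
    · have hres : b - (A + Matrix.vecMulVec ((-lam) • u) v).mulVec β
          = (lpNorm p (b - A.mulVec β) + lam * lpNorm q β) • u := by
        rw [Matrix.add_mulVec, ← sub_sub, add_smul, ← hr, ← hvβ, sub_eq_add_neg]
        rw [Matrix.vecMulVec_mulVec]
        congr 1
        ext i
        simp
        ring
      have hnn := lpNorm_nonneg hp (b - A.mulVec β)
      simp only [hres]
      rw [lpNorm_smul hp, hu, mul_one, abs_of_nonneg (by positivity)]
  · rintro _ ⟨Δ, hΔ, rfl⟩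
    simp only
    rw [Matrix.add_mulVec, ← sub_sub]
    refine (lpNorm_sub_le hp _ _).trans ?_
    gcongr
    refine (lpNorm_mulVec_le hp hq Δ β).trans ?_
    gcongr
    exact hΔ

/-- Corollary 1: for `p ∈ [1, ∞]` with conjugate exponent `p*`
(`1/p + 1/p* = 1`), `λ ≥ 0`, and the Frobenius ball `U_{F_p} = {Δ : ‖Δ‖_{F_p} ≤ λ}`,
`inf_{β ∈ Ω_adapt} sup_{Δ ∈ U_{F_p}} ‖y − (X̃ + Δ)β‖_p
  = inf_{β ∈ Ω_adapt} (‖y − X̃β‖_p + λ‖β‖_{p*})`. -/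
theorem statement10 {T m τ : ℕ} (hτ : 1 ≤ τ)
    (p pstar : ℝ≥0∞) (hp : 1 ≤ p) (hconj : 1 / p + 1 / pstar = 1)
    (lam : ℝ) (hlam : 0 ≤ lam) (X : ℤ → Fin m → ℝ) (y : ℤ → ℝ) :
    sInf ((fun β : Fin T × Fin m → ℝ =>
        sSup ((fun Δ : Matrix (Fin T) (Fin T × Fin m) ℝ =>
            lpNorm p (targetVec T y - (blockDiag T m X + Δ).mulVec β)) ''
          {Δ : Matrix (Fin T) (Fin T × Fin m) ℝ | frobNorm p Δ ≤ lam})) ''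
      OmegaAdapt T m τ X y)
    = sInf ((fun β : Fin T × Fin m → ℝ =>
        lpNorm p (targetVec T y - (blockDiag T m X).mulVec β) + lam * lpNorm pstar β) ''
      OmegaAdapt T m τ X y) := by
  have : ENNReal.HolderConjugate p pstar := by
    rw [ENNReal.holderConjugate_iff]
    simpa using hconj
  have hq : 1 ≤ pstar := ENNReal.HolderConjugate.one_le pstar p
  congr 1
  refine Set.image_congr fun β _ => ?_
  rcases isEmpty_or_nonempty (Fin T) with hT | hT
  · have himg : ((fun Δ : Matrix (Fin T) (Fin T × Fin m) ℝ =>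
        lpNorm p (targetVec T y - (blockDiag T m X + Δ).mulVec β)) ''
        {Δ : Matrix (Fin T) (Fin T × Fin m) ℝ | frobNorm p Δ ≤ lam}) = {0} := by
      simp only [lpNorm_of_isEmpty hp]
      exact Set.Nonempty.image_const ⟨0, by simpa [frobNorm, lpNorm_of_isEmpty hp] using hlam⟩ 0
    rw [himg, lpNorm_of_isEmpty hp, lpNorm_of_isEmpty hq]
    simp
  · exact (isGreatest_lpNorm_sub_mulVec hp hq hlam _ _ β).csSup_eq
end
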